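/- Let k be a field of characteristic zero and F ⊇ k a field with elements t₁, t₂, t₃, … algebraically independent over k. Suppose an element φ of the algebraic closure of k(t₁,…,t_M) in F satisfies φ = F(t₁+t₂, t₁²+t₃, …, t₁^{M−1}+t_M) = G(t₂, t₃, …, t_M) for algebraic functions F and G (i.e. φ lies both in the algebraic closure of k(t₁+t₂, …, t₁^{M−1}+t_M) and in the algebraic closure of k(t₂,…,t_M)). Then φ is algebraic over k. -/

import Mathlib

set_option synthInstance.maxHeartbeats 1000000
set_option maxHeartbeats 2000000

open scoped IntermediateField.algebraAdjoinAdjoin in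
theorem IsTranscendenceBasis.linearIndependent_D {k F ι : Type*} [Field k] [Field F] [Algebra k F]
    [CharZero F] {x : ι → F} (hx : IsTranscendenceBasis k x) :
    LinearIndependent F (fun i => KaehlerDifferential.D k F (x i)) := by
  let A := Algebra.adjoin k (Set.range x)
  let K := IntermediateField.adjoin k (Set.range x)
  let : Algebra (MvPolynomial ι k) F := (MvPolynomial.aeval x).toAlgebra
  let : Algebra (MvPolynomial ι k) A := hx.1.aevalEquiv.toRingHom.toAlgebra
  have : IsScalarTower k (MvPolynomial ι k) F :=
    .of_algebraMap_eq' (MvPolynomial.aeval x).comp_algebraMap.symm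
  have : IsScalarTower (MvPolynomial ι k) A F := .of_algebraMap_eq' rfl
  have : Algebra.FormallyEtale (MvPolynomial ι k) A :=
    .of_equiv (AlgEquiv.ofRingEquiv (f := hx.1.aevalEquiv.toRingEquiv) fun _ => rfl)
  have : Algebra.FormallyEtale A K := .of_isLocalization (nonZeroDivisors A)
  have : Algebra.IsAlgebraic K F := hx.isAlgebraic_field
  have : Algebra.FormallyEtale K F := .of_isSeparable K F
  have : Algebra.FormallyEtale A F := .comp A K F
  have : Algebra.FormallyEtale (MvPolynomial ι k) F := .comp _ A F
  let b := ((KaehlerDifferential.mvPolynomialBasis k ι).baseChange F).map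
    (KaehlerDifferential.tensorKaehlerEquivOfFormallyEtale k (MvPolynomial ι k) F)
  convert b.linearIndependent using 2 with i
  have : algebraMap (MvPolynomial ι k) F (.X i) = x i := MvPolynomial.aeval_X x i
  simp [b, this]

theorem AlgebraicIndependent.linearIndependent_D {k F ι : Type*} [Field k] [Field F] [Algebra k F]
    [CharZero F] {x : ι → F} (hx : AlgebraicIndependent k x) :
    LinearIndependent F (fun i => KaehlerDifferential.D k F (x i)) := by
  obtain ⟨s, hs, hb⟩ := exists_isTranscendenceBasis_superset hx.coe_range
  exact hb.linearIndependent_D.comp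
    (fun i => (⟨x i, hs (Set.mem_range_self i)⟩ : s))
    fun i j h => hx.injective (congrArg Subtype.val h)

theorem isAlgebraic_of_D_eq_zero {k F : Type*} [Field k] [Field F] [Algebra k F] [CharZero F]
    {a : F} (ha : KaehlerDifferential.D k F a = 0) : IsAlgebraic k a := by
  by_contra h
  have hx : AlgebraicIndependent k (fun _ : Unit => a) :=
    (algebraicIndependent_unique_type_iff).2 h
  exact hx.linearIndependent_D.ne_zero () ha

/-- The elements of `A` killed by a derivation `d` of `A`, as a subfield of the ambient field. -/
def Derivation.constants {k F M : Type*} [Field k] [Field F] [Algebra k F]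
    {A : IntermediateField k F} [AddCommGroup M] [Module k M] [Module A M]
    (d : Derivation k A M) : IntermediateField k F where
  carrier := {x | ∃ h : x ∈ A, d ⟨x, h⟩ = 0}
  mul_mem' := by
    rintro x y ⟨hx, hx'⟩ ⟨hy, hy'⟩
    refine ⟨A.mul_mem hx hy, ?_⟩
    have := d.leibniz ⟨x, hx⟩ ⟨y, hy⟩
    simpa [hx', hy'] using this
  add_mem' := by
    rintro x y ⟨hx, hx'⟩ ⟨hy, hy'⟩
    refine ⟨A.add_mem hx hy, ?_⟩
    have := d.map_add ⟨x, hx⟩ ⟨y, hy⟩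
    simpa [hx', hy'] using this
  algebraMap_mem' r := ⟨A.algebraMap_mem r, d.map_algebraMap r⟩
  inv_mem' := by
    rintro x ⟨hx, hx'⟩
    refine ⟨A.inv_mem hx, ?_⟩
    have := d.leibniz_inv ⟨x, hx⟩
    rw [hx', smul_zero] at this
    exact this

theorem Derivation.apply_eq_zero_of_isAlgebraic_constants {k F M : Type*} [Field k] [Field F]
    [CharZero F] [Algebra k F] {A : IntermediateField k F} [AddCommGroup M] [Module k M]
    [Module A M] (d : Derivation k A M) {a : A} (ha : IsAlgebraic d.constants (a : F)) :
    d a = 0 := by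
  have hle : d.constants ≤ A := fun x hx => hx.1
  let : Algebra d.constants A := (IntermediateField.inclusion hle).toRingHom.toAlgebra
  have : IsScalarTower d.constants A F := .of_algebraMap_eq' rfl
  let : Module d.constants M := Module.compHom M (algebraMap d.constants A)
  have : IsScalarTower d.constants A M := ⟨fun x y m => by
    rw [Algebra.smul_def, mul_smul]; rfl⟩
  let d' : Derivation d.constants A M :=
    { toFun := d
      map_add' := d.map_add
      map_smul' := fun c x => by
        have hc : d (algebraMap d.constants A c) = 0 := c.2.2
        rw [Algebra.smul_def, d.leibniz, hc, smul_zero, add_zero, algebraMap_smul]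
        rfl
      map_one_eq_zero' := d.map_one_eq_zero
      leibniz' := d.leibniz }
  have ha' : IsIntegral d.constants a :=
    ((isAlgebraic_algebraMap_iff (algebraMap A F).injective).1 ha).isIntegral
  have h := d'.map_aeval (minpoly d.constants a) a
  rw [minpoly.aeval, map_zero] at h
  have hsep := (minpoly.irreducible ha').separable.aeval_derivative_ne_zero (minpoly.aeval _ a)
  exact (smul_eq_zero.1 h.symm).resolve_left hsep

/-- If `a` is algebraic over `k(u)`, then `da` is a combination of the `du i` whose coefficients are
again algebraic over `k(u)`. -/
theorem exists_D_eq_sum_of_isAlgebraic_adjoin {k F : Type*} [Field k] [Field F] [CharZero F]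
    [Algebra k F] {n : Type*} [Fintype n] (u : n → F) {a : F}
    (ha : IsAlgebraic (IntermediateField.adjoin k (Set.range u)) a) :
    ∃ c : n → F, (∀ i, IsAlgebraic (IntermediateField.adjoin k (Set.range u)) (c i)) ∧
      KaehlerDifferential.D k F a = ∑ i, c i • KaehlerDifferential.D k F (u i) := by
  let K := IntermediateField.adjoin k (Set.range u)
  let A : IntermediateField k F := (algebraicClosure K F).restrictScalars k
  have hA : ∀ {x}, x ∈ A ↔ IsAlgebraic K x := mem_algebraicClosure_iff
  let N := Submodule.span A (Set.range fun i => KaehlerDifferential.D k F (u i))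
  have : IsScalarTower k A Ω[F⁄k] := .of_algebraMap_smul fun r x => by
    rw [← algebraMap_smul F r x]; rfl
  let d : Derivation k A (Ω[F⁄k] ⧸ N) :=
    N.mkQ.compDer ((KaehlerDifferential.D k F).compAlgebraMap A)
  have hd : ∀ x : A, d x = 0 ↔ KaehlerDifferential.D k F (x : F) ∈ N := fun x =>
    Submodule.Quotient.mk_eq_zero N
  have hK : K ≤ d.constants := by
    refine IntermediateField.adjoin_le_iff.2 ?_
    rintro _ ⟨i, rfl⟩
    have hi : u i ∈ K := IntermediateField.subset_adjoin k _ ⟨i, rfl⟩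
    exact ⟨hA.2 (isAlgebraic_algebraMap (⟨u i, hi⟩ : K)),
      (hd _).2 (Submodule.subset_span ⟨i, rfl⟩)⟩
  let : Algebra K d.constants := (IntermediateField.inclusion hK).toRingHom.toAlgebra
  have : IsScalarTower K d.constants F := .of_algebraMap_eq' rfl
  have h := (hd _).1 (d.apply_eq_zero_of_isAlgebraic_constants (a := ⟨a, hA.2 ha⟩)
    (ha.tower_top d.constants))
  obtain ⟨c, hc⟩ := (Submodule.mem_span_range_iff_exists_fun A).1 h
  exact ⟨fun i => c i, fun i => hA.1 (c i).2, hc.symm⟩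

/-- If `t 0, …, t (M-1)` are algebraically independent over `k` and `φ` is both
algebraic over `k(t₁+t₂, t₁²+t₃, …, t₁^{M-1}+t_M)` and over `k(t₂,…,t_M)`,
then `φ` is algebraic over `k`. (Here `t 0 = t₁`, …, `t (M-1) = t_M`.) -/
theorem stmt4 {k F : Type*} [Field k] [Field F] [Algebra k F] [CharZero F]
    (M : ℕ) (hM : 2 ≤ M) (t : ℕ → F)
    (hind : AlgebraicIndependent k (fun i : Fin M => t i))
    (φ : F)
    (h1 : IsAlgebraic
      (↥(IntermediateField.adjoin k {x : F | ∃ s, 1 ≤ s ∧ s < M ∧ x = t 0 ^ s + t s})) φ)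
    (h2 : IsAlgebraic
      (↥(IntermediateField.adjoin k {x : F | ∃ s, 1 ≤ s ∧ s < M ∧ x = t s})) φ) :
    IsAlgebraic k φ := by
  obtain ⟨n, rfl⟩ : ∃ n, M = n + 1 := ⟨M - 1, by omega⟩
  have hrange : ∀ f : ℕ → F, {x : F | ∃ s, 1 ≤ s ∧ s < n + 1 ∧ x = f s} =
      Set.range fun i : Fin n => f (i + 1) := by
    intro f
    ext x
    constructor
    · rintro ⟨s, hs, hsn, rfl⟩
      exact ⟨⟨s - 1, by omega⟩, by simp [Nat.sub_add_cancel hs]⟩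
    · rintro ⟨i, rfl⟩
      exact ⟨i + 1, by omega, by omega, rfl⟩
  rw [hrange fun s => t 0 ^ s + t s] at h1
  rw [hrange t] at h2
  have hli : ∀ (a : F) (b : Fin n → F),
      a • KaehlerDifferential.D k F (t 0) + ∑ i, b i • KaehlerDifferential.D k F (t (i + 1)) = 0 →
        a = 0 ∧ ∀ i, b i = 0 := by
    intro a b h
    have := Fintype.linearIndependent_iff.1 hind.linearIndependent_D (Fin.cons a b)
      (by simpa [Fin.sum_univ_succ] using h)
    exact ⟨this 0, fun i => this i.succ⟩
  obtain ⟨c, -, hc⟩ := exists_D_eq_sum_of_isAlgebraic_adjoin _ h1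
  obtain ⟨g, hg, hφ⟩ := exists_D_eq_sum_of_isAlgebraic_adjoin _ h2
  have hD : ∀ i : Fin n, KaehlerDifferential.D k F (t 0 ^ (i + 1 : ℕ) + t (i + 1)) =
      ((i + 1 : F) * t 0 ^ (i : ℕ)) • KaehlerDifferential.D k F (t 0) +
        KaehlerDifferential.D k F (t (i + 1)) := by
    intro i
    rw [map_add, Derivation.leibniz_pow, Nat.add_sub_cancel, ← Nat.cast_smul_eq_nsmul F, smul_smul]
    push_cast
    rfl
  have hcoef := hli (∑ i : Fin n, c i * ((i + 1 : F) * t 0 ^ (i : ℕ))) (fun i => c i - g i) (by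
    rw [hφ] at hc
    simp only [hD, smul_add, Finset.sum_add_distrib, smul_smul] at hc
    simp only [sub_smul, Finset.sum_sub_distrib, Finset.sum_smul, hc]
    abel)
  have hcg : ∀ i, c i = g i := fun i => sub_eq_zero.1 (hcoef.2 i)
  let K := IntermediateField.adjoin k (Set.range fun i : Fin n => t (i + 1))
  have ht : ¬ IsAlgebraic K (t 0) := by
    intro h
    obtain ⟨e, -, he⟩ := exists_D_eq_sum_of_isAlgebraic_adjoin _ h
    exact one_ne_zero (hli 1 (fun i => -e i) (by simp [he])).1
  let L := algebraicClosure K F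
  let G : Fin n → L := fun i => ⟨g i, mem_algebraicClosure_iff.2 (hg i)⟩
  let p : Polynomial L := ∑ i : Fin n, Polynomial.monomial i (G i * (i + 1 : L))
  have hp : p = 0 := by
    by_contra hp
    refine ht (IsAlgebraic.restrictScalars K (S := L) ⟨p, hp, ?_⟩)
    rw [← hcoef.1]
    simp [p, G, hcg, Polynomial.aeval_monomial, mul_assoc]
  have hg0 : ∀ i, g i = 0 := by
    intro i
    have h := congrArg (Polynomial.coeff · (i : ℕ)) hp
    have hi : (i + 1 : L) ≠ 0 := Nat.cast_add_one_ne_zero _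
    simp only [p, Polynomial.finsetSum_coeff, Polynomial.coeff_monomial, Fin.val_inj,
      Finset.sum_ite_eq', Finset.mem_univ, if_true, Polynomial.coeff_zero] at h
    exact congrArg Subtype.val ((mul_eq_zero.1 h).resolve_right hi)
  exact isAlgebraic_of_D_eq_zero (by simp [hφ, hg0])
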